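/- Let q be an odd prime power and d ≥ 2 be even. Then for every nonempty set A ⊆ F_q^d, one has (as an inequality of real numbers) SQ(A) ≤ |A|²/2 + q^{d/2}·|A|/2 − |A|²/(2q^{d/2}) − |A|/2. -/

import Mathlib

open Finset

/-- `‖x‖ = x₁² + ⋯ + x_d²` for `x ∈ F_q^d`. -/
def normSq {d : ℕ} {F : Type} [Field F] [Fintype F] (x : Fin d → F) : F := ∑ i, x i ^ 2

/-- `SQ(A)` : the number of pairs `(x,y) ∈ A×A` with `η(‖x−y‖) = 1`,
where `η` is the quadratic character of `F` (with `η(0) = 0`). -/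
noncomputable def SQpairs {d : ℕ} {F : Type} [Field F] [Fintype F] [DecidableEq F]
    (A : Finset (Fin d → F)) : ℕ :=
  ((A ×ˢ A).filter (fun p => quadraticChar F (normSq (p.1 - p.2)) = 1)).card

/-- The quadratic character of a finite field, with complex values. -/
noncomputable def complexQuadraticChar (F : Type) [Field F] [Fintype F] [DecidableEq F] :
    MulChar F ℂ :=
  (quadraticChar F).ringHomComp (Int.castRingHom ℂ)

lemma addChar_sum {F ι : Type*} [Field F] (ψ : AddChar F ℂ) (s : Finset ι) (f : ι → F) :
    ψ (∑ i ∈ s, f i) = ∏ i ∈ s, ψ (f i) := by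
  classical
  induction s using Finset.induction_on with
  | empty => simp
  | insert a s ha ih => rw [sum_insert ha, prod_insert ha, AddChar.map_add_eq_mul, ih]

lemma norm_sq_sum_addChar {F : Type*} [Field F] [Finite F] {d : ℕ}
    (ψ : AddChar F ℂ) (A : Finset (Fin d → F)) (m : Fin d → F) :
    ((‖∑ x ∈ A, ψ (m ⬝ᵥ x)‖ ^ 2 : ℝ) : ℂ) = ∑ x ∈ A, ∑ y ∈ A, ψ (m ⬝ᵥ (x - y)) := by
  push_cast
  rw [← Complex.mul_conj', map_sum, Finset.sum_mul_sum]
  simp_rw [dotProduct_sub, sub_eq_add_neg, AddChar.map_add_eq_mul, AddChar.map_neg_eq_conj]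

section

variable {F : Type} [Field F] [Fintype F] [DecidableEq F]

lemma complexQuadraticChar_apply (t : F) :
    complexQuadraticChar F t = ((quadraticChar F t : ℤ) : ℂ) := rfl

@[simp]
lemma complexQuadraticChar_zero : complexQuadraticChar F 0 = 0 := by
  simp [complexQuadraticChar_apply]

lemma complexQuadraticChar_isQuadratic : (complexQuadraticChar F).IsQuadratic :=
  (quadraticChar_isQuadratic F).comp _

lemma complexQuadraticChar_ne_one (hF : ringChar F ≠ 2) : complexQuadraticChar F ≠ 1 :=
  (MulChar.ringHomComp_ne_one_iff (RingHom.injective_int _)).mpr (quadraticChar_ne_one hF)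

lemma norm_complexQuadraticChar {t : F} (ht : t ≠ 0) : ‖complexQuadraticChar F t‖ = 1 := by
  rw [complexQuadraticChar_apply]
  rcases quadraticChar_dichotomy ht with h | h <;> simp [h]

lemma norm_complexQuadraticChar_le (t : F) : ‖complexQuadraticChar F t‖ ≤ 1 := by
  rcases eq_or_ne t 0 with rfl | ht
  · simp
  · exact (norm_complexQuadraticChar ht).le

lemma norm_gaussSum_sq (hF : ringChar F ≠ 2) {ψ : AddChar F ℂ} (hψ : ψ.IsPrimitive) :
    ‖gaussSum (complexQuadraticChar F) ψ‖ ^ 2 = Fintype.card F := by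
  rw [← norm_pow, gaussSum_sq (complexQuadraticChar_ne_one hF) complexQuadraticChar_isQuadratic hψ,
    norm_mul, norm_complexQuadraticChar (by simp)]
  simp

/-- The twisted Gauss sum at an arbitrary, possibly zero, frequency. -/
lemma sum_complexQuadraticChar_mul_addChar (hF : ringChar F ≠ 2) (ψ : AddChar F ℂ) (t : F) :
    ∑ u, complexQuadraticChar F u * ψ (u * t) =
      complexQuadraticChar F t * gaussSum (complexQuadraticChar F) ψ := by
  rcases eq_or_ne t 0 with rfl | ht
  · simpa using MulChar.sum_eq_zero_of_ne_one (complexQuadraticChar_ne_one hF)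
  · have h := gaussSum_mulShift_eq (complexQuadraticChar F) ψ (Units.mk0 t ht)
    rw [complexQuadraticChar_isQuadratic.inv] at h
    rw [Units.val_mk0] at h
    rw [← h, gaussSum]
    simp [AddChar.mulShift_apply, mul_comm]

lemma sum_addChar_mul_sq (hF : ringChar F ≠ 2) {ψ : AddChar F ℂ} (hψ : ψ.IsPrimitive)
    {u : F} (hu : u ≠ 0) :
    ∑ a, ψ (u * a ^ 2) =
      complexQuadraticChar F u * gaussSum (complexQuadraticChar F) ψ := by
  have hcount (t : F) :
      ((univ.filter fun a : F => a ^ 2 = t).card : ℂ) = complexQuadraticChar F t + 1 := by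
    have h := quadraticChar_card_sqrts hF t
    rw [complexQuadraticChar_apply]
    have h' : ((univ.filter fun a : F => a ^ 2 = t).card : ℤ) = quadraticChar F t + 1 := by
      rw [← h]; congr 2; ext; simp
    exact_mod_cast congrArg (Int.cast : ℤ → ℂ) h'
  have hfib : ∑ a, ψ (u * a ^ 2) =
      ∑ t, ((univ.filter fun a : F => a ^ 2 = t).card : ℂ) * ψ (t * u) := by
    rw [← Finset.sum_fiberwise' univ (fun a : F => a ^ 2) (fun t => ψ (u * t))]
    simp [mul_comm]
  rw [hfib, ← sum_complexQuadraticChar_mul_addChar hF]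
  simp_rw [hcount, add_mul, one_mul, Finset.sum_add_distrib]
  rw [AddChar.sum_mulShift u hψ]
  simp [hu]

lemma sum_addChar_quadratic (hF : ringChar F ≠ 2) {ψ : AddChar F ℂ} (hψ : ψ.IsPrimitive)
    {u : F} (hu : u ≠ 0) (b : F) :
    ∑ a, ψ (u * a ^ 2 + a * b) = ψ (u⁻¹ * (-1 / 4 * b ^ 2)) *
      (complexQuadraticChar F u * gaussSum (complexQuadraticChar F) ψ) := by
  have h2 : (2 : F) ≠ 0 := Ring.two_ne_zero hF
  have h4 : (4 : F) ≠ 0 := by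
    have : (4 : F) = 2 * 2 := by norm_num
    rw [this]; exact mul_ne_zero h2 h2
  rw [← sum_addChar_mul_sq hF hψ hu, Finset.mul_sum,
    ← Equiv.sum_comp (Equiv.subRight (b / (2 * u)))]
  refine Finset.sum_congr rfl fun a _ => ?_
  rw [← AddChar.map_add_eq_mul]
  congr 1
  simp only [Equiv.subRight_apply]
  field_simp
  ring

variable {d : ℕ}

lemma sum_addChar_normSq_add_dotProduct (hF : ringChar F ≠ 2) {ψ : AddChar F ℂ}
    (hψ : ψ.IsPrimitive) (hd : Even d) {u : F} (hu : u ≠ 0) (z : Fin d → F) :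
    ∑ m : Fin d → F, ψ (u * normSq m + m ⬝ᵥ z) =
      ψ (u⁻¹ * (-1 / 4 * normSq z)) * gaussSum (complexQuadraticChar F) ψ ^ d := by
  have hsum (m : Fin d → F) :
      ψ (u * normSq m + m ⬝ᵥ z) = ∏ i, ψ (u * m i ^ 2 + m i * z i) := by
    rw [← addChar_sum, normSq, dotProduct, Finset.mul_sum, Finset.sum_add_distrib]
  have hu1 : complexQuadraticChar F u ^ d = 1 := by
    obtain ⟨k, rfl⟩ := hd
    rw [← two_mul, pow_mul, complexQuadraticChar_apply, ← Int.cast_pow,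
      quadraticChar_sq_one hu]
    simp
  simp_rw [hsum]
  rw [← Fintype.prod_sum (fun i a => ψ (u * a ^ 2 + a * z i))]
  simp_rw [sum_addChar_quadratic hF hψ hu, Finset.prod_mul_distrib]
  rw [← addChar_sum, ← Finset.mul_sum, ← Finset.mul_sum]
  simp [hu1, normSq]

/-- The Fourier transform of `m ↦ η(‖m‖)` in even dimension. -/
lemma sum_complexQuadraticChar_normSq_mul_addChar (hF : ringChar F ≠ 2) {ψ : AddChar F ℂ}
    (hψ : ψ.IsPrimitive) (hd : Even d) (z : Fin d → F) :
    ∑ m : Fin d → F, complexQuadraticChar F (normSq m) * ψ (m ⬝ᵥ z) =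
      gaussSum (complexQuadraticChar F) ψ ^ d * complexQuadraticChar F (-1 / 4 * normSq z) := by
  set χ := complexQuadraticChar F with hχ
  set g := gaussSum χ ψ with hg
  have hg0 : g ≠ 0 := gaussSum_ne_zero_of_nontrivial (by simp)
    (complexQuadraticChar_ne_one hF) hψ
  refine mul_right_cancel₀ hg0 ?_
  calc (∑ m : Fin d → F, χ (normSq m) * ψ (m ⬝ᵥ z)) * g
      = ∑ m : Fin d → F, ∑ u, χ u * ψ (u * normSq m + m ⬝ᵥ z) := by
        rw [Finset.sum_mul]
        refine Finset.sum_congr rfl fun m _ => ?_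
        rw [mul_right_comm, ← sum_complexQuadraticChar_mul_addChar hF ψ (normSq m), Finset.sum_mul]
        simp_rw [AddChar.map_add_eq_mul, mul_assoc, hχ]
    _ = ∑ u, χ u * ∑ m : Fin d → F, ψ (u * normSq m + m ⬝ᵥ z) := by
        rw [Finset.sum_comm]
        simp_rw [Finset.mul_sum]
    _ = ∑ u, χ u * (ψ (u⁻¹ * (-1 / 4 * normSq z)) * g ^ d) := by
        refine Finset.sum_congr rfl fun u _ => ?_
        rcases eq_or_ne u 0 with rfl | hu
        · simp [hχ]
        · rw [sum_addChar_normSq_add_dotProduct hF hψ hd hu]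
    _ = ∑ u, χ u * (ψ (u * (-1 / 4 * normSq z)) * g ^ d) := by
        rw [← Equiv.sum_comp (Equiv.inv F)]
        refine Finset.sum_congr rfl fun u _ => ?_
        have hinv : χ u⁻¹ = χ u := by
          rw [← MulChar.inv_apply', complexQuadraticChar_isQuadratic.inv]
        simp [hinv]
    _ = g ^ d * χ (-1 / 4 * normSq z) * g := by
        simp_rw [← mul_assoc (χ _)]
        rw [← Finset.sum_mul, sum_complexQuadraticChar_mul_addChar hF ψ]
        ring

lemma sum_addChar_dotProduct {ψ : AddChar F ℂ} (hψ : ψ.IsPrimitive) (z : Fin d → F) :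
    ∑ m : Fin d → F, ψ (m ⬝ᵥ z) = if z = 0 then (Fintype.card F : ℂ) ^ d else 0 := by
  simp_rw [dotProduct, addChar_sum]
  rw [← Fintype.prod_sum (fun i a => ψ (a * z i))]
  simp_rw [AddChar.sum_mulShift _ hψ]
  split_ifs with hz
  · simp [hz]
  · obtain ⟨i, hi⟩ := Function.ne_iff.mp hz
    exact Finset.prod_eq_zero (mem_univ i) (by simpa using hi)

/-- Parseval's identity for the indicator function of `A`. -/
lemma sum_norm_sq_sum_addChar {ψ : AddChar F ℂ} (hψ : ψ.IsPrimitive) (A : Finset (Fin d → F)) :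
    ∑ m : Fin d → F, ‖∑ x ∈ A, ψ (m ⬝ᵥ x)‖ ^ 2 = (Fintype.card F : ℝ) ^ d * A.card := by
  have h : ((∑ m : Fin d → F, ‖∑ x ∈ A, ψ (m ⬝ᵥ x)‖ ^ 2 : ℝ) : ℂ) =
      (Fintype.card F : ℂ) ^ d * A.card := by
    rw [Complex.ofReal_sum]
    simp_rw [norm_sq_sum_addChar]
    rw [Finset.sum_comm]
    simp_rw [Finset.sum_comm (s := univ), sum_addChar_dotProduct hψ, sub_eq_zero]
    simp [mul_comm]
  exact_mod_cast h

/-- The sum of the quadratic character over all distances is controlled by its nonzero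
Fourier coefficients. -/
lemma card_pow_mul_abs_sum_quadraticChar_le (hF : ringChar F ≠ 2) {k : ℕ}
    (A : Finset (Fin (k + k) → F)) :
    (Fintype.card F : ℝ) ^ k * |∑ x ∈ A, ∑ y ∈ A, (quadraticChar F (normSq (x - y)) : ℝ)| ≤
      (Fintype.card F : ℝ) ^ (k + k) * A.card - (A.card : ℝ) ^ 2 := by
  obtain ⟨ψ, hψ⟩ : ∃ ψ : AddChar F ℂ, ψ.IsPrimitive :=
    ⟨_, AddChar.FiniteField.primitiveChar_to_Complex_isPrimitive F⟩
  have h2 : (2 : F) ≠ 0 := Ring.two_ne_zero hF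
  have h4 : (-1 / 4 : F) ≠ 0 := by
    have : (4 : F) = 2 * 2 := by norm_num
    rw [this]; exact div_ne_zero (by simp) (mul_ne_zero h2 h2)
  set χ := complexQuadraticChar F with hχ
  set g := gaussSum χ ψ with hg
  have hgnorm : ‖g ^ (k + k)‖ = (Fintype.card F : ℝ) ^ k := by
    rw [← two_mul, pow_mul, norm_pow, norm_pow, norm_gaussSum_sq hF hψ]
  have hfourier : g ^ (k + k) * (χ (-1 / 4) *
      ((∑ x ∈ A, ∑ y ∈ A, (quadraticChar F (normSq (x - y)) : ℝ) : ℝ) : ℂ)) =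
      ∑ m, χ (normSq m) * ((‖∑ x ∈ A, ψ (m ⬝ᵥ x)‖ ^ 2 : ℝ) : ℂ) := by
    simp_rw [norm_sq_sum_addChar, Finset.mul_sum]
    rw [Finset.sum_comm]
    simp_rw [Finset.sum_comm (s := univ), hχ,
      sum_complexQuadraticChar_normSq_mul_addChar hF hψ (Even.add_self k)]
    push_cast
    simp_rw [Finset.mul_sum, map_mul, complexQuadraticChar_apply]
    exact Finset.sum_comm
  have hnorm := congrArg norm hfourier
  rw [norm_mul, norm_mul, hgnorm, norm_complexQuadraticChar h4, one_mul, Complex.norm_real,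
    Real.norm_eq_abs] at hnorm
  rw [hnorm, ← sum_norm_sq_sum_addChar hψ A, ← Finset.add_sum_erase univ _ (mem_univ 0),
    ← Finset.add_sum_erase univ (fun m => ‖∑ x ∈ A, ψ (m ⬝ᵥ x)‖ ^ 2) (mem_univ 0)]
  simp only [zero_dotProduct, AddChar.map_zero_eq_one, sum_const, nsmul_eq_mul, mul_one,
    Complex.norm_natCast, add_sub_cancel_left]
  have hzero : χ (normSq (0 : Fin (k + k) → F)) = 0 := by simp [normSq, hχ]
  rw [hzero, zero_mul, zero_add]
  refine (norm_sum_le _ _).trans (Finset.sum_le_sum fun m _ => ?_)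
  rw [norm_mul, Complex.norm_real, Real.norm_of_nonneg (by positivity)]
  exact mul_le_of_le_one_left (by positivity) (norm_complexQuadraticChar_le _)

lemma two_mul_SQpairs_le (A : Finset (Fin d → F)) :
    2 * (SQpairs A : ℝ) ≤ (A.card : ℝ) ^ 2 - A.card +
      ∑ x ∈ A, ∑ y ∈ A, (quadraticChar F (normSq (x - y)) : ℝ) := by
  have hpair (x y : Fin d → F) :
      2 * (if quadraticChar F (normSq (x - y)) = 1 then (1 : ℝ) else 0) ≤
        1 - (if x = y then 1 else 0) + (quadraticChar F (normSq (x - y)) : ℝ) := by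
    rcases eq_or_ne x y with rfl | hxy
    · simp [normSq]
    · rcases quadraticChar_isQuadratic F (normSq (x - y)) with h | h | h <;>
        norm_num [h, hxy]
  have hsum := Finset.sum_le_sum fun x (_ : x ∈ A) => Finset.sum_le_sum fun y (_ : y ∈ A) =>
    hpair x y
  have hSQ : (SQpairs A : ℝ) =
      ∑ x ∈ A, ∑ y ∈ A, if quadraticChar F (normSq (x - y)) = 1 then (1 : ℝ) else 0 := by
    rw [SQpairs, ← Finset.sum_product', Finset.sum_boole]
  rw [hSQ]
  simp_rw [Finset.sum_add_distrib, Finset.sum_sub_distrib, ← Finset.mul_sum] at hsum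
  refine hsum.trans_eq ?_
  simp [sq]

end

theorem square_distances_even_general (q d : ℕ) (F : Type) [Field F] [Fintype F] [DecidableEq F]
    (hcard : Fintype.card F = q) (hodd : Odd q)
    (hd : Even d) (hd2 : 2 ≤ d)
    (A : Finset (Fin d → F)) (hAne : A.Nonempty) :
    (SQpairs A : ℝ) ≤ (A.card : ℝ) ^ 2 / 2 + (q : ℝ) ^ (d / 2) * (A.card : ℝ) / 2
      - (A.card : ℝ) ^ 2 / (2 * (q : ℝ) ^ (d / 2)) - (A.card : ℝ) / 2 := by
  subst hcard
  obtain ⟨k, rfl⟩ := hd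
  have hF : ringChar F ≠ 2 := fun h =>
    (Nat.not_even_iff_odd.mpr hodd) (FiniteField.even_card_iff_char_two.mp h |> Nat.even_iff.mpr)
  have hk : (k + k) / 2 = k := by omega
  rw [hk]
  have hQ : (0 : ℝ) < (Fintype.card F : ℝ) ^ k := by
    have := Fintype.card_pos (α := F)
    positivity
  have hbound := card_pow_mul_abs_sum_quadraticChar_le hF A
  have hcount := two_mul_SQpairs_le A
  set S := ∑ x ∈ A, ∑ y ∈ A, (quadraticChar F (normSq (x - y)) : ℝ)
  set Q := (Fintype.card F : ℝ) ^ k with hQdef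
  have hS : S ≤ Q * A.card - (A.card : ℝ) ^ 2 / Q := by
    refine (le_abs_self S).trans ?_
    refine le_of_mul_le_mul_left (hbound.trans_eq ?_) hQ
    rw [pow_add, ← hQdef]
    field_simp
  have hdiv : (A.card : ℝ) ^ 2 / (2 * Q) = (A.card : ℝ) ^ 2 / Q / 2 := by
    field_simp
  rw [hdiv]
  linarith
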